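/- For every τ in the upper half-plane ℍ, F₃(τ) − τ²·F₃(−1/τ) = ζ(3)(τ² − 1)/2 + ((2πi)³/(2τ)) · Σ_{j=0}^{2} (B_{2j}·B_{4−2j}/((2j)!·(4−2j)!))·τ^{2j}, where B_k denotes the k-th Bernoulli number (B₀ = 1, B₂ = 1/6, B₄ = −1/30). -/

import Mathlib

open scoped Real

/-- `F₃(τ) = Σ_{m≥1} Σ_{n≥1} e^{2πimnτ}/n³`. -/
noncomputable def F₃ (τ : ℂ) : ℂ :=
  ∑' m : ℕ, ∑' n : ℕ,
    Complex.exp (2 * Real.pi * Complex.I * ((m : ℂ) + 1) * ((n : ℂ) + 1) * τ) / ((n : ℂ) + 1) ^ 3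

open Complex in
/-- Lipschitz-type partial fraction expansion of the geometric series in `e^{2πiz}`. -/
theorem tsum_exp_eq_partial_fraction (z : ℂ) (hz : 0 < z.im) :
    ∑' m : ℕ, exp (2 * π * I * ((m : ℂ) + 1) * z) =
      -1 / 2 - 1 / (2 * π * I) * (1 / z + 2 * z * ∑' m : ℕ, 1 / (z ^ 2 - ((m : ℂ) + 1) ^ 2)) := by
  have hmem : z ∈ integerComplement := by
    simpa using UpperHalfPlane.coe_mem_integerComplement ⟨z, hz⟩
  have hcot := pi_mul_cot_pi_q_exp ⟨z, hz⟩
  have hr : ‖exp (2 * π * I * z)‖ < 1 := UpperHalfPlane.norm_exp_two_pi_I_lt_one ⟨z, hz⟩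
  have hser := cot_series_rep' hmem
  have hterm : ∀ m : ℕ, 1 / (z - ((m : ℂ) + 1)) + 1 / (z + ((m : ℂ) + 1)) =
      2 * z * (1 / (z ^ 2 - ((m : ℂ) + 1) ^ 2)) := fun m ↦ by
    have := cotTerm_identity hmem m
    rw [cotTerm] at this
    rw [this]
    ring_nf
  simp_rw [hterm] at hser
  rw [tsum_mul_left] at hser
  have hexp : ∀ m : ℕ, exp (2 * π * I * ((m : ℂ) + 1) * z) = exp (2 * π * I * z) ^ (m + 1) := by
    intro m
    rw [← exp_nat_mul]
    push_cast
    ring_nf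
  simp_rw [hexp]
  dsimp only at hcot
  rw [(summable_geometric_of_norm_lt_one hr).tsum_eq_zero_add] at hcot
  have hpi : (π : ℂ) ≠ 0 := by exact_mod_cast Real.pi_ne_zero
  have hI := I_ne_zero
  have key : 2 * π * I * ∑' m : ℕ, exp (2 * π * I * z) ^ (m + 1) =
      -(π * I) - (1 / z + 2 * z * ∑' m : ℕ, 1 / (z ^ 2 - ((m : ℂ) + 1) ^ 2)) := by
    linear_combination -hser + hcot
  rw [← mul_right_inj' (show (2 * π * I : ℂ) ≠ 0 by simp [hpi]), key]
  field_simp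

theorem im_mul_le_norm_mul_norm_sub (τ : ℂ) (x y : ℝ) :
    |τ.im| * |y| ≤ ‖τ‖ * ‖(x : ℂ) * τ - y‖ := by
  have h := Complex.abs_im_le_norm ((starRingEnd ℂ) τ * ((x : ℂ) * τ - y))
  rw [norm_mul, Complex.norm_conj] at h
  refine le_trans (le_of_eq ?_) h
  rw [← abs_mul]
  congr 1
  simp
  ring

theorem sq_mul_sq_le_norm_sq_mul_norm_sub (τ : ℂ) (x y : ℝ) :
    τ.im ^ 2 * y ^ 2 ≤ ‖τ‖ ^ 2 * ‖((x : ℂ) * τ) ^ 2 - (y : ℂ) ^ 2‖ := by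
  have h₁ := im_mul_le_norm_mul_norm_sub τ x y
  have h₂ := im_mul_le_norm_mul_norm_sub τ x (-y)
  rw [abs_neg, Complex.ofReal_neg, sub_neg_eq_add] at h₂
  calc τ.im ^ 2 * y ^ 2 = (|τ.im| * |y|) * (|τ.im| * |y|) := by
        rw [← sq_abs τ.im, ← sq_abs y]; ring
    _ ≤ (‖τ‖ * ‖(x : ℂ) * τ - y‖) * (‖τ‖ * ‖(x : ℂ) * τ + y‖) := by gcongr
    _ = ‖τ‖ ^ 2 * (‖(x : ℂ) * τ - y‖ * ‖(x : ℂ) * τ + y‖) := by ring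
    _ = _ := by rw [← norm_mul]; congr 2; ring

theorem natCast_mul_sq_sub_sq_ne_zero {τ : ℂ} (hτ : 0 < τ.im) (n m : ℕ) :
    (((n : ℂ) + 1) * τ) ^ 2 - ((m : ℂ) + 1) ^ 2 ≠ 0 := by
  intro h
  have := sq_mul_sq_le_norm_sq_mul_norm_sub τ ((n : ℝ) + 1) ((m : ℝ) + 1)
  push_cast at this
  rw [h, norm_zero, mul_zero] at this
  have : 0 < τ.im ^ 2 * ((m : ℝ) + 1) ^ 2 := by positivity
  linarith

theorem summable_one_div_natCast_add_one_pow {k : ℕ} (hk : 1 < k) :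
    Summable fun n : ℕ ↦ 1 / ((n : ℝ) + 1) ^ k := by
  simpa using (summable_nat_add_iff 1).2 (Real.summable_one_div_nat_pow.2 hk)

/-- The general term of the double series obtained by expanding `F₃` in partial fractions. -/
noncomputable def grosswaldTerm (τ : ℂ) (p : ℕ × ℕ) : ℂ :=
  1 / (((p.1 : ℂ) + 1) ^ 2 * ((((p.1 : ℂ) + 1) * τ) ^ 2 - ((p.2 : ℂ) + 1) ^ 2))

theorem summable_grosswaldTerm {τ : ℂ} (hτ : 0 < τ.im) : Summable (grosswaldTerm τ) := by
  have hs := summable_one_div_natCast_add_one_pow one_lt_two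
  have hs2 := (hs.mul_of_nonneg hs (fun _ ↦ by positivity) (fun _ ↦ by positivity)).mul_left
    (‖τ‖ ^ 2 / τ.im ^ 2)
  refine Summable.of_norm_bounded hs2 fun p ↦ ?_
  obtain ⟨n, m⟩ := p
  have hb := sq_mul_sq_le_norm_sq_mul_norm_sub τ ((n : ℝ) + 1) ((m : ℝ) + 1)
  have h0 := norm_pos_iff.2 (natCast_mul_sq_sub_sq_ne_zero hτ n m)
  have hn : ‖(n : ℂ) + 1‖ = (n : ℝ) + 1 := by
    exact_mod_cast Complex.norm_natCast (n + 1)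
  push_cast at hb
  simp only [grosswaldTerm, norm_div, norm_one, norm_mul, norm_pow, hn]
  rw [show ‖τ‖ ^ 2 / τ.im ^ 2 * (1 / ((n : ℝ) + 1) ^ 2 * (1 / ((m : ℝ) + 1) ^ 2)) =
    ‖τ‖ ^ 2 / (τ.im ^ 2 * ((m : ℝ) + 1) ^ 2 * ((n : ℝ) + 1) ^ 2) by field_simp,
    div_le_div_iff₀ (by positivity) (by positivity)]
  nlinarith [mul_le_mul_of_nonneg_right hb (sq_nonneg ((n : ℝ) + 1))]

open Complex in
theorem summable_exp_div_pow_three {τ : ℂ} (hτ : 0 < τ.im) :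
    Summable fun p : ℕ × ℕ ↦
      exp (2 * π * I * ((p.1 : ℂ) + 1) * ((p.2 : ℂ) + 1) * τ) / ((p.2 : ℂ) + 1) ^ 3 := by
  have hr : ‖exp (2 * π * I * τ)‖ < 1 := UpperHalfPlane.norm_exp_two_pi_I_lt_one ⟨τ, hτ⟩
  have hg := (summable_nat_add_iff 1).2 (summable_geometric_of_lt_one (norm_nonneg _) hr)
  refine Summable.of_norm_bounded (hg.mul_of_nonneg
    (summable_one_div_natCast_add_one_pow (show 1 < 3 by norm_num))
    (fun _ ↦ by positivity) (fun _ ↦ by positivity)) fun p ↦ ?_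
  obtain ⟨m, n⟩ := p
  have hn : ‖(n : ℂ) + 1‖ = (n : ℝ) + 1 := by
    exact_mod_cast Complex.norm_natCast (n + 1)
  have hexp : exp (2 * π * I * ((m : ℂ) + 1) * ((n : ℂ) + 1) * τ) =
      exp (2 * π * I * τ) ^ ((m + 1) * (n + 1)) := by
    rw [← exp_nat_mul]
    push_cast
    ring_nf
  dsimp only
  rw [hexp, norm_div, norm_pow, norm_pow, hn, div_eq_mul_one_div]
  refine mul_le_mul_of_nonneg_right ?_ (by positivity)
  exact pow_le_pow_of_le_one (norm_nonneg _) hr.le (Nat.le_mul_of_pos_right _ n.succ_pos)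

theorem riemannZeta_natCast_eq_tsum_add_one {k : ℕ} (hk : 1 < k) :
    riemannZeta k = ∑' n : ℕ, 1 / ((n : ℂ) + 1) ^ k := by
  rw [zeta_eq_tsum_one_div_nat_add_one_cpow (by simpa using hk)]
  simp

theorem summable_complex_one_div_natCast_add_one_pow {k : ℕ} (hk : 1 < k) :
    Summable fun n : ℕ ↦ 1 / ((n : ℂ) + 1) ^ k := by
  have := Complex.summable_ofReal.2 (summable_one_div_natCast_add_one_pow hk)
  simpa using this

open Complex in
theorem tsum_exp_div_pow_three {τ : ℂ} (hτ : 0 < τ.im) (n : ℕ) :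
    ∑' m : ℕ, exp (2 * π * I * ((m : ℂ) + 1) * ((n : ℂ) + 1) * τ) / ((n : ℂ) + 1) ^ 3 =
      -1 / 2 * (1 / ((n : ℂ) + 1) ^ 3) - 1 / (2 * π * I) * (1 / τ * (1 / ((n : ℂ) + 1) ^ 4) +
        2 * τ * ∑' m : ℕ, grosswaldTerm τ (n, m)) := by
  have hτ0 : τ ≠ 0 := by rintro rfl; simp at hτ
  have hn : (n : ℂ) + 1 ≠ 0 := n.cast_add_one_ne_zero
  have him : 0 < (((n : ℂ) + 1) * τ).im := by
    have : (((n : ℂ) + 1) * τ).im = ((n : ℝ) + 1) * τ.im := by simp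
    rw [this]
    positivity
  have hg : ∑' m : ℕ, grosswaldTerm τ (n, m) = 1 / ((n : ℂ) + 1) ^ 2 *
      ∑' m : ℕ, 1 / ((((n : ℂ) + 1) * τ) ^ 2 - ((m : ℂ) + 1) ^ 2) := by
    rw [← tsum_mul_left]
    exact tsum_congr fun m ↦ by rw [grosswaldTerm, one_div_mul_one_div]
  have h := tsum_exp_eq_partial_fraction _ him
  simp_rw [← mul_assoc (2 * π * I * (_ + 1) : ℂ)] at h
  rw [tsum_div_const, h, hg]
  generalize ∑' m : ℕ, 1 / ((((n : ℂ) + 1) * τ) ^ 2 - ((m : ℂ) + 1) ^ 2) = S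
  have hpi : (π : ℂ) ≠ 0 := by exact_mod_cast Real.pi_ne_zero
  have hI := I_ne_zero
  field_simp

theorem F₃_eq_tsum_grosswaldTerm {τ : ℂ} (hτ : 0 < τ.im) :
    F₃ τ = -riemannZeta 3 / 2 -
      1 / (2 * π * Complex.I) * (riemannZeta 4 / τ + 2 * τ * ∑' p, grosswaldTerm τ p) := by
  have hs3 := summable_complex_one_div_natCast_add_one_pow (show 1 < 3 by norm_num)
  have hs4 := summable_complex_one_div_natCast_add_one_pow (show 1 < 4 by norm_num)
  have hsg := summable_grosswaldTerm hτ
  have hz3 := riemannZeta_natCast_eq_tsum_add_one (show 1 < 3 by norm_num)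
  have hz4 := riemannZeta_natCast_eq_tsum_add_one (show 1 < 4 by norm_num)
  push_cast at hz3 hz4
  have h := (hs3.hasSum.mul_left (-1 / 2)).sub <|
    ((hs4.hasSum.mul_left (1 / τ)).add (hsg.prod.hasSum.mul_left (2 * τ))).mul_left
      (1 / (2 * π * Complex.I))
  rw [← hz3, ← hz4, ← hsg.tsum_prod] at h
  have hcomm := (summable_exp_div_pow_three hτ).tsum_comm
    (f := fun m n : ℕ ↦ Complex.exp (2 * π * Complex.I * ((m : ℂ) + 1) * ((n : ℂ) + 1) * τ) /
      ((n : ℂ) + 1) ^ 3)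
  rw [F₃, ← hcomm, tsum_congr (tsum_exp_div_pow_three hτ), h.tsum_eq]
  ring

theorem neg_one_div_im_pos {τ : ℂ} (hτ : 0 < τ.im) : 0 < (-1 / τ).im := by
  simpa [neg_div] using UpperHalfPlane.im_inv_neg_coe_pos ⟨τ, hτ⟩

theorem grosswaldTerm_add_swap {τ : ℂ} (hτ : 0 < τ.im) (n m : ℕ) :
    grosswaldTerm τ (n, m) + grosswaldTerm (-1 / τ) (m, n) =
      -(1 / ((n : ℂ) + 1) ^ 2 * (1 / ((m : ℂ) + 1) ^ 2)) := by
  have hτ0 : τ ≠ 0 := by rintro rfl; simp at hτ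
  have hn : (n : ℂ) + 1 ≠ 0 := n.cast_add_one_ne_zero
  have hm : (m : ℂ) + 1 ≠ 0 := m.cast_add_one_ne_zero
  have hd := natCast_mul_sq_sub_sq_ne_zero hτ n m
  have heq : (((m : ℂ) + 1) * (-1 / τ)) ^ 2 - ((n : ℂ) + 1) ^ 2 =
      -((((n : ℂ) + 1) * τ) ^ 2 - ((m : ℂ) + 1) ^ 2) / τ ^ 2 := by
    field_simp
    ring
  simp only [grosswaldTerm]
  rw [heq]
  generalize hD : (((n : ℂ) + 1) * τ) ^ 2 - ((m : ℂ) + 1) ^ 2 = D at *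
  field_simp
  linear_combination -hD

theorem tsum_grosswaldTerm_add_tsum {τ : ℂ} (hτ : 0 < τ.im) :
    ∑' p, grosswaldTerm τ p + ∑' p, grosswaldTerm (-1 / τ) p = -riemannZeta 2 ^ 2 := by
  have hs := summable_complex_one_div_natCast_add_one_pow one_lt_two
  have hz2 := riemannZeta_natCast_eq_tsum_add_one one_lt_two
  have hswap := (summable_grosswaldTerm (neg_one_div_im_pos hτ)).prod_symm
  push_cast at hz2
  rw [← (Equiv.prodComm ℕ ℕ).tsum_eq (grosswaldTerm (-1 / τ)), hz2, sq,
    tsum_mul_tsum_of_summable_norm hs.norm hs.norm, ← tsum_neg]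
  refine ((summable_grosswaldTerm hτ).tsum_add hswap).symm.trans ?_
  exact tsum_congr fun p ↦ grosswaldTerm_add_swap hτ p.1 p.2

theorem F₃_grosswald (τ : ℂ) (hτ : 0 < τ.im) :
    F₃ τ - τ ^ 2 * F₃ (-1 / τ) =
      riemannZeta 3 * (τ ^ 2 - 1) / 2 +
        (2 * Real.pi * Complex.I) ^ 3 / (2 * τ) *
          ∑ j ∈ Finset.range 3,
            ((bernoulli (2 * j) * bernoulli (4 - 2 * j) : ℚ) : ℂ) /
                ((Nat.factorial (2 * j) * Nat.factorial (4 - 2 * j) : ℕ) : ℂ) *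
              τ ^ (2 * j) := by
  have hτ0 : τ ≠ 0 := by rintro rfl; simp at hτ
  have hpi : (π : ℂ) ≠ 0 := by exact_mod_cast Real.pi_ne_zero
  have hI := Complex.I_ne_zero
  have hB4 : bernoulli 4 = -1 / 30 := by
    rw [bernoulli_eq_bernoulli'_of_ne_one (by norm_num), bernoulli'_four]
  have hsum : ∑ j ∈ Finset.range 3,
      ((bernoulli (2 * j) * bernoulli (4 - 2 * j) : ℚ) : ℂ) /
        ((Nat.factorial (2 * j) * Nat.factorial (4 - 2 * j) : ℕ) : ℂ) * τ ^ (2 * j) =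
      -1 / 720 + τ ^ 2 / 144 - τ ^ 4 / 720 := by
    simp [Finset.sum_range_succ, bernoulli_two, hB4, Nat.factorial]
    ring
  rw [hsum, F₃_eq_tsum_grosswaldTerm hτ, F₃_eq_tsum_grosswaldTerm (neg_one_div_im_pos hτ),
    eq_sub_of_add_eq' (tsum_grosswaldTerm_add_tsum hτ), riemannZeta_two, riemannZeta_four]
  generalize ∑' p, grosswaldTerm τ p = S
  have hI4 : Complex.I ^ 4 = 1 := Complex.I_pow_four
  field_simp
  ring_nf
  simp only [hI4]
  ring
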